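/- arXiv:2605.13567 — 2 statements merged into one kernel-verified Lean document; each statement's English description precedes it below -/
import Mathlib

section
/- Let m be a positive integer and let S be a 3-graph such that Δ₂(S) ≤ 2 and, for every subset U ⊆ V(S) with |U| ≤ m, the induced subgraph S[U] is sparse. Then every subgraph H of cone(S) with v(H) ≤ m satisfies λ(H) ≤ 4/9. -/
/-- The codegree `d(u,v)`: the number of vertices `w` with `{u,v,w} ∈ E`. -/
def codeg {n : ℕ} (E : Finset (Finset (Fin n))) (u v : Fin n) : ℕ :=
  (Finset.univ.filter (fun w => ({u, v, w} : Finset (Fin n)) ∈ E)).card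

/-- The cone of a 3-graph: add a new apex vertex (here `Fin.last n`), all triples
consisting of the apex together with two distinct old vertices, and keep all old edges. -/
def coneEdges {n : ℕ} (E : Finset (Finset (Fin n))) : Finset (Finset (Fin (n + 1))) :=
  E.image (Finset.image Fin.castSucc) ∪
    (Finset.univ : Finset (Finset (Fin (n + 1)))).filter
      (fun e => e.card = 3 ∧ Fin.last n ∈ e)

/-- The normalized Lagrangian of the 3-graph with edge set `E` on vertex set `Fin n`:
the supremum of `6·Σ_{e ∈ E} Π_{i ∈ e} x i` over probability vectors `x`. -/
noncomputable def lagrangian {n : ℕ} (E : Finset (Finset (Fin n))) : ℝ :=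
  sSup {p : ℝ | ∃ x : Fin n → ℝ, (∀ i, 0 ≤ x i) ∧ (∑ i, x i) = 1 ∧
    p = 6 * ∑ e ∈ E, ∏ i ∈ e, x i}

/-- Twice the second elementary symmetric sum plus the sum of squares is the square of the sum. -/
theorem two_mul_sum_powersetCard_two_add_sum_sq {ι : Type*} [DecidableEq ι] (s : Finset ι)
    (y : ι → ℝ) :
    2 * ∑ p ∈ s.powersetCard 2, ∏ i ∈ p, y i + ∑ i ∈ s, y i ^ 2 = (∑ i ∈ s, y i) ^ 2 := by
  induction s using Finset.induction_on with
  | empty => rw [Finset.powersetCard_eq_empty.2 (by simp)]; simp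
  | insert a s ha ih =>
    have hdisj : Disjoint (s.powersetCard 2) ((s.powersetCard 1).image (insert a)) := by
      rw [Finset.disjoint_left]
      intro p hp hp'
      obtain ⟨q, -, rfl⟩ := Finset.mem_image.1 hp'
      exact ha ((Finset.mem_powersetCard.1 hp).1 (Finset.mem_insert_self a q))
    have hinj : Set.InjOn (insert a) (s.powersetCard 1 : Set (Finset ι)) := by
      intro p hp q hq hpq
      have hp' : a ∉ p := fun h => ha ((Finset.mem_powersetCard.1 hp).1 h)
      have hq' : a ∉ q := fun h => ha ((Finset.mem_powersetCard.1 hq).1 h)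
      rw [← Finset.erase_insert hp', ← Finset.erase_insert hq']
      exact congrArg (fun r => Finset.erase r a) hpq
    have hpair : ∑ p ∈ s.powersetCard 1, ∏ i ∈ insert a p, y i = y a * ∑ i ∈ s, y i := by
      rw [Finset.powersetCard_one, Finset.sum_map, Finset.mul_sum]
      refine Finset.sum_congr rfl fun i hi => ?_
      have hai : a ≠ i := fun h => ha (h ▸ hi)
      simpa using Finset.prod_pair hai
    rw [Finset.powersetCard_succ_insert ha, Finset.sum_union hdisj, Finset.sum_image hinj, hpair,
      Finset.sum_insert ha, Finset.sum_insert ha]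
    linear_combination ih

/-- In a sparse hypergraph on `insert u (insert v R)`, where `u` and `v` carry the largest values
of `f`, edge weights bounded by the values of `f` on the edge sum to at most `∑ i ∈ R, f i`
(also after subtracting a common lower bound `c`). -/
theorem sum_sub_le_of_sparse {ι : Type*} [DecidableEq ι] (E : Finset (Finset ι)) (f : ι → ℝ)
    (g : Finset ι → ℝ) (hg : ∀ e ∈ E, ∀ i ∈ e, g e ≤ f i) (u v : ι) (huv : u ≠ v)
    (R : Finset ι) :
    u ∉ R → v ∉ R → (∀ i ∈ R, f i ≤ f u) → (∀ i ∈ R, f i ≤ f v) →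
    (∀ T ⊆ insert u (insert v R), 2 ≤ T.card → (E.filter (· ⊆ T)).card ≤ T.card - 2) →
    ∀ c, (∀ i ∈ R, c ≤ f i) →
      ∑ e ∈ E.filter (· ⊆ insert u (insert v R)), (g e - c) ≤ ∑ i ∈ R, (f i - c) := by
  induction R using Finset.induction_on_min_value f with
  | empty =>
    intro _ _ _ _ hsp c _
    have hcard := hsp _ subset_rfl (by simp [Finset.card_pair huv])
    have hcard' : (insert u (insert v (∅ : Finset ι))).card = 2 := by
      simp [Finset.card_pair huv]
    rw [hcard', Nat.sub_self, Nat.le_zero, Finset.card_eq_zero] at hcard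
    rw [hcard]
    simp
  | insert w R hw hmin ih =>
    intro hu hv hfu hfv hsp c hc
    have huR : u ∉ R := fun h => hu (Finset.mem_insert_of_mem h)
    have hvR : v ∉ R := fun h => hv (Finset.mem_insert_of_mem h)
    have hsub : insert u (insert v R) ⊆ insert u (insert v (insert w R)) := by
      intro i; simp only [Finset.mem_insert]; tauto
    have hIH := ih huR hvR (fun i hi => hfu i (Finset.mem_insert_of_mem hi))
      (fun i hi => hfv i (Finset.mem_insert_of_mem hi))
      (fun T hT => hsp T (hT.trans hsub)) (f w) hmin
    have hcard : (insert u (insert v (insert w R))).card = R.card + 3 := by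
      rw [Finset.card_insert_of_notMem, Finset.card_insert_of_notMem hv,
        Finset.card_insert_of_notMem hw]
      simp only [Finset.mem_insert] at hu ⊢
      tauto
    have hE := hsp _ subset_rfl (by omega)
    rw [hcard, show R.card + 3 - 2 = R.card + 1 by omega] at hE
    have hE' : ((E.filter (· ⊆ insert u (insert v (insert w R)))).card : ℝ) ≤ R.card + 1 := by
      exact_mod_cast hE
    have hdrop : ∑ e ∈ E.filter (· ⊆ insert u (insert v (insert w R))), (g e - f w) ≤
        ∑ e ∈ E.filter (· ⊆ insert u (insert v R)), (g e - f w) := by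
      rw [Finset.sum_filter, Finset.sum_filter]
      refine Finset.sum_le_sum fun e he => ?_
      split_ifs with h2 h h
      · rfl
      · have hwe : w ∈ e := by
          by_contra hwe
          refine h fun i hi => ?_
          have := h2 hi
          simp only [Finset.mem_insert] at this ⊢
          rcases this with h | h | h | h
          · exact Or.inl h
          · exact Or.inr (Or.inl h)
          · exact absurd (h ▸ hi) hwe
          · exact Or.inr (Or.inr h)
        linarith [hg e he w hwe]
      · exact absurd (h.trans hsub) h2
      · rfl
    have hcw := hc w (Finset.mem_insert_self w R)
    rw [Finset.sum_insert hw]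
    simp only [Finset.sum_sub_distrib, Finset.sum_const, nsmul_eq_mul] at hdrop hIH ⊢
    nlinarith [mul_le_mul_of_nonneg_right hE' (sub_nonneg.2 hcw)]

/-- Bounded codegree: at most two edges arise from a given pair by adding one vertex. -/
theorem card_filter_erase_eq_le_two {t : ℕ} {E : Finset (Finset (Fin t))}
    (hcodeg : ∀ u v : Fin t, u ≠ v → codeg E u v ≤ 2) (w : Finset (Fin t) → Fin t)
    (hw : ∀ e ∈ E, w e ∈ e) {p : Finset (Fin t)} (hp : p.card = 2) :
    (E.filter (fun e => e.erase (w e) = p)).card ≤ 2 := by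
  obtain ⟨a, b, hab, rfl⟩ := Finset.card_eq_two.1 hp
  refine le_trans (Finset.card_le_card_of_injOn w ?_ ?_) (hcodeg a b hab)
  · intro e he
    simp only [Finset.coe_filter, Set.mem_ofPred_eq] at he
    have h := Finset.insert_erase (hw e he.1)
    rw [he.2] at h
    simp only [Finset.coe_filter, Finset.mem_univ, true_and, Set.mem_ofPred_eq]
    have h' : ({a, b, w e} : Finset (Fin t)) = e := by
      refine Eq.trans ?_ h
      ext i; simp only [Finset.mem_insert, Finset.mem_singleton]; tauto
    rw [h']
    exact he.1
  · intro e he e' he' hee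
    simp only [Finset.coe_filter, Set.mem_ofPred_eq] at he he'
    rw [← Finset.insert_erase (hw e he.1), ← Finset.insert_erase (hw e' he'.1), he.2, he'.2, hee]

/-- The edge polynomial of a sparse 3-graph with codegrees at most two, compared with the cube of
the total weight and with the total weight times the sum of squares. -/
theorem sum_prod_le_of_sparse {t : ℕ} (E : Finset (Finset (Fin t)))
    (huniform : ∀ e ∈ E, e.card = 3)
    (hcodeg : ∀ u v : Fin t, u ≠ v → codeg E u v ≤ 2) (T : Finset (Fin t))
    (hE : ∀ e ∈ E, e ⊆ T)
    (hsp : ∀ U ⊆ T, 2 ≤ U.card → (E.filter (· ⊆ U)).card ≤ U.card - 2)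
    (y : Fin t → ℝ) (hy : ∀ i, 0 ≤ y i) :
    27 * ∑ e ∈ E, ∏ i ∈ e, y i ≤ (∑ i ∈ T, y i) ^ 3 ∧
      5 * ∑ e ∈ E, ∏ i ∈ e, y i ≤ (∑ i ∈ T, y i) * ∑ i ∈ T, y i ^ 2 := by
  have hs0 : 0 ≤ ∑ i ∈ T, y i := Finset.sum_nonneg fun i _ => hy i
  have hq0 : 0 ≤ ∑ i ∈ T, y i ^ 2 := Finset.sum_nonneg fun i _ => sq_nonneg _
  rcases lt_or_ge T.card 2 with hT | hT
  · have : E = ∅ := by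
      refine Finset.eq_empty_of_forall_notMem fun e he => ?_
      have := Finset.card_le_card (hE e he)
      have := huniform e he
      omega
    subst this
    simp only [Finset.sum_empty, mul_zero]
    exact ⟨by positivity, by positivity⟩
  obtain ⟨u, huT, hu⟩ := Finset.exists_max_image T y (Finset.card_pos.1 (by omega))
  obtain ⟨v, hvT, hv⟩ := Finset.exists_max_image (T.erase u) y
    (Finset.card_pos.1 (by rw [Finset.card_erase_of_mem huT]; omega))
  have hvu : v ≠ u := (Finset.mem_erase.1 hvT).1
  set R := (T.erase u).erase v with hR
  have hTR : insert u (insert v R) = T := by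
    rw [hR, Finset.insert_erase hvT, Finset.insert_erase huT]
  have huR : u ∉ R := by simp [hR]
  have hvR : v ∉ R := by simp [hR]
  have hRu : ∀ i ∈ R, y i ≤ y u := fun i hi =>
    hu i (Finset.mem_of_mem_erase (Finset.mem_of_mem_erase hi))
  have hRv : ∀ i ∈ R, y i ≤ y v := fun i hi => hv i (Finset.mem_of_mem_erase hi)
  have huvR : u ∉ insert v R := by
    simp only [Finset.mem_insert, not_or]; exact ⟨hvu.symm, huR⟩
  have hEne : ∀ e ∈ E, ∃ w ∈ e, ∀ i ∈ e, y w ≤ y i := fun e he =>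
    Finset.exists_min_image e y (Finset.card_pos.1 (by rw [huniform e he]; omega))
  have : Nonempty (Fin t) := ⟨u⟩
  choose! w hwe hmin using hEne
  have hfilter : E.filter (· ⊆ insert u (insert v R)) = E := by
    rw [hTR]; exact Finset.filter_true_of_mem hE
  have hlin : ∑ e ∈ E, y (w e) ≤ ∑ i ∈ R, y i := by
    have := sum_sub_le_of_sparse E y (fun e => y (w e)) hmin u v hvu.symm R huR hvR hRu hRv
      (by rw [hTR]; exact hsp) 0 (fun i _ => hy i)
    simpa only [hfilter, sub_zero] using this
  have hsq : ∑ e ∈ E, y (w e) ^ 2 ≤ ∑ i ∈ R, y i ^ 2 := by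
    have := sum_sub_le_of_sparse E (fun i => y i ^ 2) (fun e => y (w e) ^ 2)
      (fun e he i hi => pow_le_pow_left₀ (hy _) (hmin e he i hi) 2) u v hvu.symm R huR hvR
      (fun i hi => pow_le_pow_left₀ (hy _) (hRu i hi) 2)
      (fun i hi => pow_le_pow_left₀ (hy _) (hRv i hi) 2)
      (by rw [hTR]; exact hsp) 0 (fun i _ => sq_nonneg _)
    simpa only [hfilter, sub_zero] using this
  have hfactor : ∀ e ∈ E, ∏ i ∈ e, y i = y (w e) * ∏ i ∈ e.erase (w e), y i := fun e he =>
    (Finset.mul_prod_erase e y (hwe e he)).symm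
  have hcard : ∀ e ∈ E, (e.erase (w e)).card = 2 := fun e he => by
    rw [Finset.card_erase_of_mem (hwe e he), huniform e he]
  have hpair : ∀ e ∈ E, ∏ i ∈ e.erase (w e), y i ≤ y u * y v := by
    intro e he
    obtain ⟨i, j, hij, hp⟩ := Finset.card_eq_two.1 (hcard e he)
    have hiT : i ∈ T := hE e he (Finset.mem_of_mem_erase (a := w e) (by rw [hp]; simp))
    have hjT : j ∈ T := hE e he (Finset.mem_of_mem_erase (a := w e) (by rw [hp]; simp))
    rw [hp, Finset.prod_pair hij]
    by_cases hiu : i = u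
    · subst hiu
      exact mul_le_mul_of_nonneg_left (hv j (Finset.mem_erase.2 ⟨hij.symm, hjT⟩)) (hy _)
    · rw [mul_comm]
      exact mul_le_mul (hu j hjT) (hv i (Finset.mem_erase.2 ⟨hiu, hiT⟩)) (hy _) (hy _)
  have htop : ∑ e ∈ E, ∏ i ∈ e, y i ≤ y u * y v * ∑ i ∈ R, y i := by
    calc ∑ e ∈ E, ∏ i ∈ e, y i ≤ ∑ e ∈ E, y u * y v * y (w e) := by
          refine Finset.sum_le_sum fun e he => ?_
          rw [hfactor e he, mul_comm]
          exact mul_le_mul_of_nonneg_right (hpair e he) (hy _)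
      _ = y u * y v * ∑ e ∈ E, y (w e) := (Finset.mul_sum _ _ _).symm
      _ ≤ _ := mul_le_mul_of_nonneg_left hlin (mul_nonneg (hy _) (hy _))
  have hpairs : ∑ e ∈ E, (∏ i ∈ e.erase (w e), y i) ^ 2 ≤ (∑ i ∈ T, y i ^ 2) ^ 2 := by
    have hmaps : ∀ e ∈ E, e.erase (w e) ∈ T.powersetCard 2 := fun e he =>
      Finset.mem_powersetCard.2 ⟨(Finset.erase_subset _ _).trans (hE e he), hcard e he⟩
    rw [← Finset.sum_fiberwise_of_maps_to hmaps]
    calc _ ≤ ∑ p ∈ T.powersetCard 2, 2 * ∏ i ∈ p, y i ^ 2 := by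
          refine Finset.sum_le_sum fun p hp => ?_
          have hconst : ∑ e ∈ E.filter (fun e => e.erase (w e) = p),
              (∏ i ∈ e.erase (w e), y i) ^ 2 =
              ∑ e ∈ E.filter (fun e => e.erase (w e) = p), ∏ i ∈ p, y i ^ 2 := by
            refine Finset.sum_congr rfl fun e he => ?_
            rw [(Finset.mem_filter.1 he).2, Finset.prod_pow]
          rw [hconst, Finset.sum_const, nsmul_eq_mul]
          refine mul_le_mul_of_nonneg_right ?_ (Finset.prod_nonneg fun i _ => sq_nonneg _)
          exact_mod_cast card_filter_erase_eq_le_two hcodeg w hwe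
            (Finset.mem_powersetCard.1 hp).2
      _ ≤ _ := by
          rw [← Finset.mul_sum, ← two_mul_sum_powersetCard_two_add_sum_sq T (fun i => y i ^ 2)]
          exact le_add_of_nonneg_right (Finset.sum_nonneg fun i _ => sq_nonneg _)
  have hcs : (∑ e ∈ E, ∏ i ∈ e, y i) ^ 2 ≤ (∑ i ∈ R, y i ^ 2) * (∑ i ∈ T, y i ^ 2) ^ 2 := by
    rw [Finset.sum_congr rfl hfactor]
    refine (Finset.sum_mul_sq_le_sq_mul_sq E _ _).trans ?_
    exact mul_le_mul hsq hpairs (Finset.sum_nonneg fun _ _ => sq_nonneg _)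
      (Finset.sum_nonneg fun _ _ => sq_nonneg _)
  have hsT : ∑ i ∈ T, y i = y u + y v + ∑ i ∈ R, y i := by
    rw [← hTR, Finset.sum_insert huvR, Finset.sum_insert hvR]; ring
  have hqT : ∑ i ∈ T, y i ^ 2 = y u ^ 2 + y v ^ 2 + ∑ i ∈ R, y i ^ 2 := by
    rw [← hTR, Finset.sum_insert huvR, Finset.sum_insert hvR]; ring
  have hr0 : 0 ≤ ∑ i ∈ R, y i := Finset.sum_nonneg fun i _ => hy i
  generalize ∑ i ∈ R, y i = r at *
  generalize ∑ i ∈ R, y i ^ 2 = q at *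
  generalize ∑ e ∈ E, ∏ i ∈ e, y i = Z at *
  generalize ∑ i ∈ T, y i = s at *
  generalize ∑ i ∈ T, y i ^ 2 = Q at *
  have hu0 := hy u
  have hv0 := hy v
  generalize y u = a at *
  generalize y v = b at *
  have hab : a * b ≤ ((a + b) / 2) ^ 2 := by nlinarith [sq_nonneg (a - b)]
  have hZ : Z ≤ ((a + b) / 2) ^ 2 * r := htop.trans (mul_le_mul_of_nonneg_right hab hr0)
  obtain ⟨c, hc⟩ : ∃ c, c = (a + b) / 2 := ⟨_, rfl⟩
  have hc0 : 0 ≤ c := by rw [hc]; positivity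
  rw [← hc] at hZ
  have hrs : r = s - 2 * c := by rw [hc, hsT]; ring
  constructor
  · have : 0 ≤ (s - 3 * c) ^ 2 * (s + 6 * c) := by positivity
    rw [hrs] at hZ
    nlinarith
  · rcases le_total (25 * q) (s ^ 2) with h | h
    · refine le_of_sq_le_sq ?_ (mul_nonneg hs0 hq0)
      nlinarith [mul_le_mul_of_nonneg_right h (sq_nonneg Q)]
    · have hQ : 2 * c ^ 2 + s ^ 2 / 25 ≤ Q := by
        rw [hqT, hc]; nlinarith [sq_nonneg (a - b)]
      have h1 := mul_le_mul_of_nonneg_left hQ hs0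
      have : 0 ≤ (5 * c - s) ^ 2 * (10 * c + s) := by positivity
      rw [hrs] at hZ
      nlinarith

/-- Triples through the apex contribute the apex weight times the second elementary symmetric sum
of the other weights. -/
theorem sum_prod_filter_last_mem_le {t : ℕ} (x : Fin (t + 1) → ℝ) (hx : ∀ i, 0 ≤ x i) :
    ∑ e ∈ (Finset.univ : Finset (Finset (Fin (t + 1)))).filter
        (fun e => e.card = 3 ∧ Fin.last t ∈ e), ∏ i ∈ e, x i ≤
      x (Fin.last t) *
        ∑ p ∈ (Finset.univ : Finset (Fin t)).powersetCard 2, ∏ i ∈ p, x i.castSucc := by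
  have hlast : ∀ p : Finset (Fin t), Fin.last t ∉ p.image Fin.castSucc := by
    intro p h
    obtain ⟨i, -, hi⟩ := Finset.mem_image.1 h
    exact Fin.castSucc_ne_last i hi
  have hsub : (Finset.univ : Finset (Finset (Fin (t + 1)))).filter
      (fun e => e.card = 3 ∧ Fin.last t ∈ e) ⊆
      ((Finset.univ : Finset (Fin t)).powersetCard 2).image
        (fun p => insert (Fin.last t) (p.image Fin.castSucc)) := by
    intro e he
    simp only [Finset.mem_filter, Finset.mem_univ, true_and] at he
    have heq : insert (Fin.last t) ((Finset.univ.filter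
        (fun i : Fin t => i.castSucc ∈ e)).image Fin.castSucc) = e := by
      ext j
      refine Fin.lastCases ?_ (fun i => ?_) j
      · simp [he.2]
      · simp [Fin.castSucc_ne_last]
    refine Finset.mem_image.2 ⟨_, Finset.mem_powersetCard.2 ⟨Finset.subset_univ _, ?_⟩, heq⟩
    have hcard := congrArg Finset.card heq
    rw [Finset.card_insert_of_notMem (hlast _),
      Finset.card_image_of_injective _ (Fin.castSucc_injective t), he.1] at hcard
    omega
  refine (Finset.sum_le_sum_of_subset_of_nonneg hsub
    fun e _ _ => Finset.prod_nonneg fun i _ => hx i).trans ?_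
  rw [Finset.sum_image, Finset.mul_sum]
  · refine (Finset.sum_congr rfl fun p _ => ?_).le
    rw [Finset.prod_insert (hlast p), Finset.prod_image (Fin.castSucc_injective t).injOn]
  · intro p _ q _ hpq
    refine Finset.image_injective (Fin.castSucc_injective t) ?_
    rw [← Finset.erase_insert (hlast p), ← Finset.erase_insert (hlast q)]
    exact congrArg (fun r => Finset.erase r (Fin.last t)) hpq

/-- Let `S` be a 3-graph with maximum codegree at most 2 all of whose induced subgraphs
on at most `m` vertices are sparse. Then every subgraph `H` of `cone(S)` with at most
`m` vertices (vertex set `W`, edges contained in `W`) satisfies `λ(H) ≤ 4/9`. -/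
theorem cone_small_subgraphs (m : ℕ) (hm : 0 < m) (t : ℕ) (E : Finset (Finset (Fin t)))
    (huniform : ∀ e ∈ E, e.card = 3)
    (hcodeg : ∀ u v : Fin t, u ≠ v → codeg E u v ≤ 2)
    (hlocal : ∀ U : Finset (Fin t), U.card ≤ m →
      ∀ T ⊆ U, 2 ≤ T.card → (E.filter (· ⊆ T)).card ≤ T.card - 2) :
    ∀ (W : Finset (Fin (t + 1))) (H : Finset (Finset (Fin (t + 1)))),
      H ⊆ coneEdges E → (∀ e ∈ H, e ⊆ W) → W.card ≤ m →
      lagrangian H ≤ 4 / 9 := by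
  intro W H hH hHW hWm
  refine Real.sSup_le ?_ (by norm_num)
  rintro p ⟨x, hx, hx1, rfl⟩
  set T := Finset.univ.filter (fun i : Fin t => i.castSucc ∈ W) with hT
  set y : Fin t → ℝ := fun i => x i.castSucc with hy
  set F := E.filter (· ⊆ T) with hF
  have hTm : T.card ≤ m := by
    refine le_trans (Finset.card_le_card_of_injOn Fin.castSucc ?_
      (Fin.castSucc_injective t).injOn) hWm
    intro i hi
    simpa [hT] using hi
  have hFE : F ⊆ E := Finset.filter_subset _ _
  obtain ⟨hcube, hsquare⟩ := sum_prod_le_of_sparse F (fun e he => huniform e (hFE he))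
    (fun u v huv => (Finset.card_le_card
      (Finset.monotone_filter_right _ fun w _ hw => hFE hw)).trans (hcodeg u v huv)) T
    (fun e he => (Finset.mem_filter.1 he).2)
    (fun U hU hU2 => (Finset.card_le_card (Finset.filter_subset_filter _ hFE)).trans
      (hlocal T hTm U hU hU2)) y (fun i => hx _)
  have hprod : ∀ e : Finset (Fin (t + 1)), 0 ≤ ∏ i ∈ e, x i := fun e =>
    Finset.prod_nonneg fun i _ => hx i
  have hsplit : ∑ e ∈ H, ∏ i ∈ e, x i ≤ ∑ e ∈ F, ∏ i ∈ e, y i +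
      x (Fin.last t) * ∑ p ∈ (Finset.univ : Finset (Fin t)).powersetCard 2, ∏ i ∈ p, y i := by
    have hsub : H ⊆ F.image (Finset.image Fin.castSucc) ∪
        (Finset.univ : Finset (Finset (Fin (t + 1)))).filter
          (fun e => e.card = 3 ∧ Fin.last t ∈ e) := by
      intro e he
      rcases Finset.mem_union.1 (hH he) with h | h
      · obtain ⟨e', he', rfl⟩ := Finset.mem_image.1 h
        refine Finset.mem_union_left _ (Finset.mem_image_of_mem _ (Finset.mem_filter.2
          ⟨he', fun i hi => ?_⟩))
        simpa [hT] using hHW _ he (Finset.mem_image_of_mem _ hi)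
      · exact Finset.mem_union_right _ h
    refine (Finset.sum_le_sum_of_subset_of_nonneg hsub fun e _ _ => hprod e).trans ?_
    have himage : ∑ e ∈ F.image (Finset.image Fin.castSucc), ∏ i ∈ e, x i =
        ∑ e ∈ F, ∏ i ∈ e, y i := by
      rw [Finset.sum_image (Finset.image_injective (Fin.castSucc_injective t)).injOn]
      exact Finset.sum_congr rfl fun e _ =>
        Finset.prod_image (Fin.castSucc_injective t).injOn
    have hunion := Finset.sum_union_inter (s₁ := F.image (Finset.image Fin.castSucc))
      (s₂ := (Finset.univ : Finset (Finset (Fin (t + 1)))).filter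
          (fun e => e.card = 3 ∧ Fin.last t ∈ e)) (f := fun e => ∏ i ∈ e, x i)
    have hinter : 0 ≤ ∑ e ∈ F.image (Finset.image Fin.castSucc) ∩
        (Finset.univ : Finset (Finset (Fin (t + 1)))).filter
          (fun e => e.card = 3 ∧ Fin.last t ∈ e), ∏ i ∈ e, x i :=
      Finset.sum_nonneg fun e _ => hprod e
    linarith [sum_prod_filter_last_mem_le x hx]
  have hpairs := two_mul_sum_powersetCard_two_add_sum_sq Finset.univ y
  rw [Fin.sum_univ_castSucc] at hx1
  have hsT : ∑ i ∈ T, y i ≤ ∑ i, y i :=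
    Finset.sum_le_sum_of_subset_of_nonneg (Finset.subset_univ _) fun i _ _ => hx _
  have hqT : ∑ i ∈ T, y i ^ 2 ≤ ∑ i, y i ^ 2 :=
    Finset.sum_le_sum_of_subset_of_nonneg (Finset.subset_univ _) fun i _ _ => sq_nonneg _
  have hs0 : 0 ≤ ∑ i ∈ T, y i := Finset.sum_nonneg fun i _ => hx _
  have hq0 : 0 ≤ ∑ i ∈ T, y i ^ 2 := Finset.sum_nonneg fun i _ => sq_nonneg _
  have ha0 := hx (Fin.last t)
  have hs : ∑ i, y i = 1 - x (Fin.last t) := by linarith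
  rw [hs] at hsT hpairs
  generalize x (Fin.last t) = a at *
  have hcube' := hcube.trans (pow_le_pow_left₀ hs0 hsT 3)
  have hsquare' := hsquare.trans (mul_le_mul hsT hqT hq0 (hs0.trans hsT))
  have hQ0 := hq0.trans hqT
  have ha1 : a ≤ 1 := by linarith
  refine (mul_le_mul_of_nonneg_left hsplit (by norm_num)).trans ?_
  generalize ∑ e ∈ F, ∏ i ∈ e, y i = Z at *
  generalize ∑ i, y i ^ 2 = Q at *
  generalize ∑ p ∈ (Finset.univ : Finset (Fin t)).powersetCard 2, ∏ i ∈ p, y i = P at *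
  have hkey : 2 * Z - a * Q ≤ (1 - 3 * a) ^ 2 * (4 - 3 * a) / 27 := by
    rcases le_total (2 * (1 - a)) (5 * a) with h | h
    · have h1 : 0 ≤ (1 - 3 * a) ^ 2 * (4 - 3 * a) :=
        mul_nonneg (sq_nonneg _) (by linarith)
      nlinarith [mul_le_mul_of_nonneg_right h hQ0]
    · have hpos : 0 < 1 - a := by linarith
      have h1 : (1 - a) * (2 * Z - a * Q) ≤ (1 - a) * ((1 - a) ^ 2 * (2 - 7 * a) / 27) := by
        nlinarith [mul_le_mul_of_nonneg_left hsquare' ha0,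
          mul_le_mul_of_nonneg_right hcube' (show 0 ≤ 2 - 7 * a by linarith)]
      have h2 := le_of_mul_le_mul_left h1 hpos
      have h3 : 0 ≤ a ^ 2 * (2 / 7 - a) := mul_nonneg (sq_nonneg _) (by linarith)
      nlinarith [sq_nonneg (a - 1 / 4)]
  have hP : a * (2 * P + Q) = a * (1 - a) ^ 2 := by rw [hpairs]
  nlinarith
end

section
/- Let c and q be real numbers with c > 0 and 0 ≤ q ≤ c/6. Then the maximum over b ∈ [0,1] of the function f(b) = 3cb²(1−b) + 6qb³ equals 4c³/(9(c−2q)²), and it is attained at b₀ = 2c/(3(c−2q)) ∈ [0,1]. -/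
/-- For `c > 0` and `0 ≤ q ≤ c/6`, the maximum over `b ∈ [0,1]` of
`f(b) = 3cb²(1-b) + 6qb³` equals `4c³/(9(c-2q)²)`, and it is attained at
`b₀ = 2c/(3(c-2q)) ∈ [0,1]`. -/
theorem interior_maximum (c q : ℝ) (hc : 0 < c) (hq0 : 0 ≤ q) (hq : q ≤ c / 6) :
    2 * c / (3 * (c - 2 * q)) ∈ Set.Icc (0 : ℝ) 1 ∧
    IsGreatest ((fun b : ℝ => 3 * c * b ^ 2 * (1 - b) + 6 * q * b ^ 3) '' Set.Icc 0 1)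
      (4 * c ^ 3 / (9 * (c - 2 * q) ^ 2)) ∧
    3 * c * (2 * c / (3 * (c - 2 * q))) ^ 2 * (1 - 2 * c / (3 * (c - 2 * q)))
        + 6 * q * (2 * c / (3 * (c - 2 * q))) ^ 3
      = 4 * c ^ 3 / (9 * (c - 2 * q) ^ 2) := by
  have hd : 0 < c - 2 * q := by linarith
  have hmem : 2 * c / (3 * (c - 2 * q)) ∈ Set.Icc (0 : ℝ) 1 :=
    ⟨by positivity, by rw [div_le_one (by positivity)]; linarith⟩
  have hval : 3 * c * (2 * c / (3 * (c - 2 * q))) ^ 2 * (1 - 2 * c / (3 * (c - 2 * q)))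
        + 6 * q * (2 * c / (3 * (c - 2 * q))) ^ 3
      = 4 * c ^ 3 / (9 * (c - 2 * q) ^ 2) := by
    have hd' := hd.ne'
    field_simp
    ring
  refine ⟨hmem, ⟨⟨_, hmem, hval⟩, ?_⟩, hval⟩
  rintro _ ⟨b, ⟨hb, -⟩, rfl⟩
  have hfactor : 0 ≤ (3 * (c - 2 * q) * b - 2 * c) ^ 2 * (3 * (c - 2 * q) * b + c) := by
    positivity
  rw [le_div_iff₀ (by positivity)]
  linear_combination hfactor
end
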